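/- Let V ⊆ ℂ be a nonempty simply connected domain and let ρ be a holomorphic function on V. Then every smooth real-valued function u on V satisfying the system 4 ∂_z ∂_z̄ u = e^(−2u) and ∂²_zz u + (∂_z u)² = −ρ/4 is of the form u = log(|w₁|² + |w₂|²), where w₁, w₂ are holomorphic functions on V solving Hill's equation w'' + (ρ/4) w = 0 with Wronskian w₁ w₂' − w₂ w₁' = 1/2 on V. -/

import Mathlib

/-- The Wirtinger derivative `∂_z f = (1/2)(∂_x f - i ∂_y f)`. -/
noncomputable def wirtingerZ (f : ℂ → ℂ) (z : ℂ) : ℂ :=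
  (1 / 2) * (fderiv ℝ f z 1 - Complex.I * fderiv ℝ f z Complex.I)

/-- The conjugate Wirtinger derivative `∂_z̄ f = (1/2)(∂_x f + i ∂_y f)`. -/
noncomputable def wirtingerZbar (f : ℂ → ℂ) (z : ℂ) : ℂ :=
  (1 / 2) * (fderiv ℝ f z 1 + Complex.I * fderiv ℝ f z Complex.I)

open Filter Topology Set in
/-- Two primitives of the same function differ by a locally constant function. -/
theorem eventually_sub_eq_of_hasDerivAt {F G f : ℂ → ℂ} {x : ℂ} {U : Set ℂ} (hU : IsOpen U)
    (hx : x ∈ U) (hF : ∀ z ∈ U, HasDerivAt F (f z) z) (hG : ∀ z ∈ U, HasDerivAt G (f z) z) :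
    ∀ᶠ y in 𝓝 x, F y - G y = F x - G x := by
  obtain ⟨r, hr, hrU⟩ := Metric.isOpen_iff.1 hU x hx
  filter_upwards [Metric.ball_mem_nhds x hr] with y hy
  have h : ∀ z ∈ Metric.ball x r, HasDerivAt (fun z => F z - G z) 0 z := fun z hz =>
    sub_self (f z) ▸ (hF z (hrU hz)).sub (hG z (hrU hz))
  exact Metric.isOpen_ball.is_const_of_deriv_eq_zero (convex_ball x r).isPreconnected
    (fun z hz => (h z hz).differentiableAt.differentiableWithinAt) (fun z hz => (h z hz).deriv)
    hy (Metric.mem_ball_self hr)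

open Filter Topology Set in
/-- The bundle of primitives, with discrete fibers, of a function with local primitives `F i`
on `U i`. -/
noncomputable def primitiveBundleCore {V : Set ℂ} (f : ℂ → ℂ) (U : V → Set ℂ)
    (F : V → ℂ → ℂ) (hU : ∀ i, IsOpen (U i)) (hmem : ∀ i : V, (i : ℂ) ∈ U i)
    (hF : ∀ i, ∀ z ∈ U i, HasDerivAt (F i) (f z) z) :
    FiberBundleCore V V (WithDiscreteTopology ℂ) where
  baseSet i := Subtype.val ⁻¹' U i
  isOpen_baseSet i := (hU i).preimage continuous_subtype_val
  indexAt x := x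
  mem_baseSet_at := hmem
  coordChange i j x v := .toTopology ⊥ (v.ofTopology + (F i x - F j x))
  coordChange_self i x _ v := by simp
  continuousOn_coordChange i j := by
    rintro ⟨x, v⟩ ⟨⟨hi, hj⟩, -⟩
    refine ContinuousAt.continuousWithinAt ?_
    have h := eventually_sub_eq_of_hasDerivAt ((hU i).inter (hU j)) ⟨hi, hj⟩
      (fun z hz => hF i z hz.1) (fun z hz => hF j z hz.2)
    have h' : ∀ᶠ y : V in 𝓝 x, F i y - F j y = F i x - F j x :=
      continuous_subtype_val.continuousAt.eventually h
    have hv : ∀ᶠ w in 𝓝 v, w = v := by simp [nhds_discrete]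
    refine (continuousAt_const (y := WithTopology.toTopology ⊥ (v.ofTopology + (F i x - F j x)))).congr ?_
    filter_upwards [h'.prod_nhds hv] with p hp
    rw [hp.1, hp.2]
  coordChange_comp i j k x _ v := by
    congr 1
    simp only
    ring

open Filter Topology Set in
/-- A holomorphic function on a simply connected open set has a primitive. -/
theorem exists_primitive_of_simplyConnected {V : Set ℂ} (hV : IsOpen V)
    [SimplyConnectedSpace V] {f : ℂ → ℂ} (hf : DifferentiableOn ℂ f V) :
    ∃ F : ℂ → ℂ, ∀ z ∈ V, HasDerivAt F (f z) z := by
  have hloc : ∀ i : V, ∃ U : Set ℂ, IsOpen U ∧ (i : ℂ) ∈ U ∧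
      ∃ F : ℂ → ℂ, ∀ z ∈ U, HasDerivAt F (f z) z := fun i => by
    obtain ⟨r, hr, hrV⟩ := Metric.isOpen_iff.1 hV i i.2
    exact ⟨_, Metric.isOpen_ball, Metric.mem_ball_self hr, (hf.mono hrV).isExactOn_ball⟩
  choose U hU hmem F hF using hloc
  let Z := primitiveBundleCore f U F hU hmem hF
  have := hV.locallyPathConnectedSpace
  obtain ⟨x₀⟩ : Nonempty V := inferInstance
  have hcov : IsCoveringMap (Bundle.TotalSpace.proj : Z.TotalSpace → V) :=
    FiberBundle.isCoveringMap (F := WithDiscreteTopology ℂ) (E := Z.Fiber)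
  obtain ⟨s, ⟨-, hs⟩, -⟩ := hcov.existsUnique_continuousMap_lifts (ContinuousMap.id V) x₀
    ⟨x₀, (WithTopology.toTopology ⊥ (0 : ℂ))⟩ rfl
  have hs' : ∀ x, (s x).1 = x := fun x => congrFun hs x
  let P : V → ℂ := fun x => WithTopology.ofTopology (t := ⊥) (s x).2 + F x x
  have key : ∀ x : V, ∀ᶠ y : V in 𝓝 x, P y = P x - F x x + F x y := fun x => by
    have hc : ContinuousAt (fun y => (Z.localTriv x (s y)).2) x := by
      refine continuousAt_snd.comp (ContinuousAt.comp (f := s) ?_ s.continuous.continuousAt)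
      refine (Z.localTriv x).continuousAt ?_
      rw [Z.mem_localTriv_source, hs']
      exact hmem x
    have hval : ∀ y, (Z.localTriv x (s y)).2 =
        WithTopology.toTopology ⊥ (P y - F x y) := fun y => by
      rw [Z.localTriv_apply]
      change WithTopology.toTopology ⊥ (WithTopology.ofTopology (t := ⊥) (s y).2 +
        (F (s y).1 (s y).1 - F x (s y).1)) = _
      rw [hs']
      simp only [P]
      congr 1
      ring
    have := hc.eventually (by rw [nhds_discrete]; exact eventually_pure.2 rfl :
      ∀ᶠ v in 𝓝 ((Z.localTriv x (s x)).2), v = (Z.localTriv x (s x)).2)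
    filter_upwards [this] with y hy
    rw [hval, hval] at hy
    have := congrArg WithTopology.ofTopology hy
    simp only at this
    linear_combination this
  classical
  refine ⟨fun z => if hz : z ∈ V then P ⟨z, hz⟩ else 0, fun z hz => ?_⟩
  have h1 := key ⟨z, hz⟩
  rw [nhds_subtype_eq_comap, eventually_comap] at h1
  refine ((hF ⟨z, hz⟩ z (hmem ⟨z, hz⟩)).const_add
    (P ⟨z, hz⟩ - F ⟨z, hz⟩ z)).congr_of_eventuallyEq ?_
  filter_upwards [h1, hV.mem_nhds hz] with y hy hyV
  simpa [hyV] using hy ⟨y, hyV⟩ rfl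

/-- A pair `(w, v)` of holomorphic functions with `w' = v`, `v' = q w` on `V`. -/
def IsHillPair (q : ℂ → ℂ) (V : Set ℂ) (w v : ℂ → ℂ) : Prop :=
  ∀ z ∈ V, HasDerivAt w (v z) z ∧ HasDerivAt v (q z * w z) z

namespace IsHillPair

variable {q : ℂ → ℂ} {V : Set ℂ} {w v w₁ v₁ w₂ v₂ : ℂ → ℂ}

theorem differentiableOn (h : IsHillPair q V w v) : DifferentiableOn ℂ w V :=
  fun z hz => (h z hz).1.differentiableAt.differentiableWithinAt

theorem deriv_eq (h : IsHillPair q V w v) {z : ℂ} (hz : z ∈ V) : deriv w z = v z :=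
  (h z hz).1.deriv

theorem deriv_deriv_eq (h : IsHillPair q V w v) (hV : IsOpen V) {z : ℂ} (hz : z ∈ V) :
    deriv (deriv w) z = q z * w z := by
  have : deriv w =ᶠ[nhds z] v := by
    filter_upwards [hV.mem_nhds hz] with y hy using h.deriv_eq hy
  rw [this.deriv_eq, (h z hz).2.deriv]

/-- The Wronskian of two solutions is constant. -/
theorem wronskian_eq (h₁ : IsHillPair q V w₁ v₁) (h₂ : IsHillPair q V w₂ v₂) (hV : IsOpen V)
    (hVc : IsPreconnected V) {x y : ℂ} (hx : x ∈ V) (hy : y ∈ V) :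
    w₁ x * v₂ x - w₂ x * v₁ x = w₁ y * v₂ y - w₂ y * v₁ y := by
  have h : ∀ z ∈ V, HasDerivAt (fun z => w₁ z * v₂ z - w₂ z * v₁ z) 0 z := fun z hz => by
    refine (((h₁ z hz).1.mul (h₂ z hz).2).sub ((h₂ z hz).1.mul (h₁ z hz).2)).congr_deriv ?_
    ring
  exact hV.is_const_of_deriv_eq_zero hVc
    (fun z hz => (h z hz).differentiableAt.differentiableWithinAt) (fun z hz => (h z hz).deriv)
    hx hy

theorem const_mul (h : IsHillPair q V w v) (c : ℂ) :
    IsHillPair q V (fun z => c * w z) (fun z => c * v z) := fun z hz =>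
  ⟨(h z hz).1.const_mul c, ((h z hz).2.const_mul c).congr_deriv (by ring)⟩

/-- Two solutions with the same initial data agree, provided that there is a pair of linearly
independent solutions. -/
theorem eq_of_initial (h : IsHillPair q V w v) {w₃ v₃ : ℂ → ℂ} (h₃ : IsHillPair q V w₃ v₃)
    (h₁ : IsHillPair q V w₁ v₁) (h₂ : IsHillPair q V w₂ v₂) (hV : IsOpen V)
    (hVc : IsPreconnected V) {z₀ : ℂ} (hz₀ : z₀ ∈ V)
    (hW : w₁ z₀ * v₂ z₀ - w₂ z₀ * v₁ z₀ ≠ 0) (hw : w z₀ = w₃ z₀) (hv : v z₀ = v₃ z₀)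
    {z : ℂ} (hz : z ∈ V) : w z = w₃ z := by
  have e₁ := h.wronskian_eq h₁ hV hVc hz hz₀
  have e₁' := h₃.wronskian_eq h₁ hV hVc hz hz₀
  have e₂ := h.wronskian_eq h₂ hV hVc hz hz₀
  have e₂' := h₃.wronskian_eq h₂ hV hVc hz hz₀
  rw [← h₁.wronskian_eq h₂ hV hVc hz hz₀] at hW
  rw [hw, hv, ← e₁'] at e₁
  rw [hw, hv, ← e₂'] at e₂
  refine mul_right_cancel₀ hW ?_
  linear_combination w₁ z * e₂ - w₂ z * e₁

end IsHillPair

open Filter Topology Set in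
/-- Picard iterates for Hill's equation on a simply connected open set. -/
theorem exists_hill_iterates {q : ℂ → ℂ} {V : Set ℂ} (hV : IsOpen V) [SimplyConnectedSpace V]
    (hq : DifferentiableOn ℂ q V) (z₀ α β : ℂ) :
    ∃ a b : ℕ → ℂ → ℂ, (∀ z, a 0 z = α ∧ b 0 z = β) ∧ (∀ n, a (n + 1) z₀ = 0 ∧ b (n + 1) z₀ = 0) ∧
      ∀ n, ∀ z ∈ V, HasDerivAt (a (n + 1)) (b n z) z ∧
        HasDerivAt (b (n + 1)) (q z * a n z) z := by
  let X := {f : ℂ → ℂ // DifferentiableOn ℂ f V}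
  have hstep : ∀ f : X, ∃ F : X, F.1 z₀ = 0 ∧ ∀ z ∈ V, HasDerivAt F.1 (f.1 z) z := fun f => by
    obtain ⟨F, hF⟩ := exists_primitive_of_simplyConnected hV f.2
    have hF' : ∀ z ∈ V, HasDerivAt (fun z => F z - F z₀) (f.1 z) z := fun z hz =>
      (hF z hz).sub_const _
    exact ⟨⟨fun z => F z - F z₀, fun z hz => (hF' z hz).differentiableAt.differentiableWithinAt⟩,
      sub_self _, hF'⟩
  choose I hI₀ hI using hstep
  let Y : ℕ → X × X := fun n => Nat.rec
    (⟨fun _ => α, differentiableOn_const _⟩, ⟨fun _ => β, differentiableOn_const _⟩)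
    (fun _ p => (I p.2, I ⟨fun z => q z * p.1.1 z, hq.mul p.1.2⟩)) n
  exact ⟨fun n => (Y n).1.1, fun n => (Y n).2.1, fun z => ⟨rfl, rfl⟩,
    fun n => ⟨hI₀ _, hI₀ _⟩, fun n z hz => ⟨hI _ z hz, hI _ z hz⟩⟩

/-- A nonnegative sequence that contracts up to a summable error is summable. -/
theorem summable_of_le_add_half {c B : ℕ → ℝ} (hc : Summable c) (hc₀ : ∀ n, 0 ≤ c n)
    (hB₀ : ∀ n, 0 ≤ B n) (h0 : B 0 ≤ c 0) (h : ∀ n, B (n + 1) ≤ c (n + 1) + B n / 2) :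
    Summable B := by
  refine summable_of_sum_range_le (c := 2 * ∑' n, c n) hB₀ fun n => ?_
  have key : ∀ n, ∑ i ∈ Finset.range (n + 1), B i + B n ≤
      2 * ∑ i ∈ Finset.range (n + 1), c i := fun n => by
    induction n with
    | zero => simp; linarith
    | succ n ih =>
      rw [Finset.sum_range_succ, Finset.sum_range_succ c]
      linarith [h n]
  have h1 := hc.sum_le_tsum (Finset.range (n + 1)) fun i _ => hc₀ i
  have h2 := key n
  rw [Finset.sum_range_succ] at h2
  linarith [hB₀ n]

open Filter Topology Set in
/-- Near every point, summability of the Picard iterates at one point implies a uniform summable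
bound. -/
theorem exists_ball_summable_bound {q : ℂ → ℂ} {V : Set ℂ} (hV : IsOpen V)
    (hq : ContinuousOn q V) {a b : ℕ → ℂ → ℂ} {α β : ℂ} (h0 : ∀ z, a 0 z = α ∧ b 0 z = β)
    (hab : ∀ n, ∀ z ∈ V, HasDerivAt (a (n + 1)) (b n z) z ∧
        HasDerivAt (b (n + 1)) (q z * a n z) z) {x : ℂ} (hx : x ∈ V) :
    ∃ r > 0, Metric.ball x r ⊆ V ∧ ∃ K : ℝ, 0 ≤ K ∧ (∀ z ∈ Metric.ball x r, ‖q z‖ ≤ K) ∧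
      ∀ y ∈ Metric.ball x r, Summable (fun n => ‖a n y‖ + ‖b n y‖) →
      ∃ B : ℕ → ℝ, Summable B ∧ ∀ n, ∀ z ∈ Metric.ball x r, ‖a n z‖ + ‖b n z‖ ≤ B n := by
  set K : ℝ := ‖q x‖ + 1 with hK
  have hK0 : 0 < K := by positivity
  have hev : ∀ᶠ z in 𝓝 x, ‖q z‖ ≤ K ∧ z ∈ V :=
    (((hq.continuousAt (hV.mem_nhds hx)).norm.eventually_lt continuousAt_const
      (lt_add_one ‖q x‖)).mono fun _ h => h.le).and (hV.mem_nhds hx)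
  obtain ⟨R, hR, hRb⟩ := Metric.eventually_nhds_iff_ball.1 hev
  set r := min R (1 / (4 * (1 + K))) with hr
  have hr0 : 0 < r := lt_min hR (by positivity)
  have hrR : Metric.ball x r ⊆ Metric.ball x R := Metric.ball_subset_ball (min_le_left _ _)
  have hrK : 2 * r * (1 + K) ≤ 1 / 2 := by
    have : r ≤ 1 / (4 * (1 + K)) := min_le_right _ _
    rw [le_div_iff₀ (by positivity)] at this
    linarith
  refine ⟨r, hr0, fun z hz => (hRb z (hrR hz)).2, K, hK0.le, fun z hz => (hRb z (hrR hz)).1,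
    fun y hy hsum => ?_⟩
  let c : ℕ → ℝ := fun n => ‖a n y‖ + ‖b n y‖
  let B : ℕ → ℝ := fun n => Nat.rec (c 0) (fun k p => c (k + 1) + p / 2) n
  have hc0 : ∀ n, 0 ≤ c n := fun n => by positivity
  have hB0 : ∀ n, 0 ≤ B n := fun n => by
    induction n with
    | zero => exact hc0 0
    | succ n ih => exact add_nonneg (hc0 _) (by positivity)
  refine ⟨B, summable_of_le_add_half hsum hc0 hB0 le_rfl fun n => le_rfl, fun n => ?_⟩
  induction n with
  | zero => 
    intro z _
    change _ ≤ c 0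
    simp only [c, h0, le_refl]
  | succ n ih =>
    intro z hz
    have hd : ‖z - y‖ ≤ 2 * r := by
      rw [← dist_eq_norm]
      linarith [dist_triangle_right z y x, Metric.mem_ball.1 hz, Metric.mem_ball.1 hy]
    have ha := (convex_ball x r).norm_image_sub_le_of_norm_hasDerivWithin_le (C := B n)
      (fun w hw => (hab n w (hRb w (hrR hw)).2).1.hasDerivWithinAt)
      (fun w hw => by linarith [ih w hw, norm_nonneg (a n w)]) hy hz
    have hb := (convex_ball x r).norm_image_sub_le_of_norm_hasDerivWithin_le (C := K * B n)
      (fun w hw => (hab n w (hRb w (hrR hw)).2).2.hasDerivWithinAt)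
      (fun w hw => by
        rw [norm_mul]
        exact mul_le_mul (hRb w (hrR hw)).1 (by linarith [ih w hw, norm_nonneg (b n w)])
          (norm_nonneg _) hK0.le) hy hz
    have ha' := norm_le_norm_add_norm_sub' (a (n + 1) z) (a (n + 1) y)
    have hb' := norm_le_norm_add_norm_sub' (b (n + 1) z) (b (n + 1) y)
    have hBn := hB0 n
    have h1 : B n * ‖z - y‖ + K * B n * ‖z - y‖ ≤ B n / 2 := by
      calc B n * ‖z - y‖ + K * B n * ‖z - y‖ = ‖z - y‖ * (1 + K) * B n := by ring
        _ ≤ 2 * r * (1 + K) * B n := by gcongr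
        _ ≤ 1 / 2 * B n := by gcongr
        _ = B n / 2 := by ring
    change _ ≤ c (n + 1) + B n / 2
    simp only [c]
    linarith

open Filter Topology Set in
/-- Global solvability of the initial value problem for Hill's equation on a simply connected
open set. -/
theorem exists_isHillPair {q : ℂ → ℂ} {V : Set ℂ} (hV : IsOpen V) [SimplyConnectedSpace V]
    (hq : DifferentiableOn ℂ q V) {z₀ : ℂ} (hz₀ : z₀ ∈ V) (α β : ℂ) :
    ∃ w v : ℂ → ℂ, IsHillPair q V w v ∧ w z₀ = α ∧ v z₀ = β := by
  obtain ⟨a, b, h0, hz, hab⟩ := exists_hill_iterates hV hq z₀ α β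
  have hVc : IsPreconnected V := isPreconnected_iff_preconnectedSpace.2 inferInstance
  have hloc := fun x hx => exists_ball_summable_bound hV hq.continuousOn h0 hab (x := x) hx
  have hsum₀ : Summable fun n => ‖a n z₀‖ + ‖b n z₀‖ := by
    refine summable_of_ne_finset_zero (s := {0}) fun n hn => ?_
    obtain ⟨k, rfl⟩ := Nat.exists_eq_succ_of_ne_zero (by simpa using hn)
    simp [hz]
  have hsum : ∀ x ∈ V, Summable fun n => ‖a n x‖ + ‖b n x‖ := fun x hx => by
    refine hVc.induction₂' (fun x y => (Summable fun n => ‖a n x‖ + ‖b n x‖) →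
      Summable fun n => ‖a n y‖ + ‖b n y‖) (fun x hx => ?_) (fun x y z _ _ _ h k => k ∘ h)
      hz₀ hx hsum₀
    obtain ⟨r, hr, -, K, -, -, hB⟩ := hloc x hx
    refine mem_nhdsWithin_of_mem_nhds ?_
    filter_upwards [Metric.ball_mem_nhds x hr] with y hy
    have hxb := Metric.mem_ball_self (x := x) hr
    have aux : ∀ s ∈ Metric.ball x r, ∀ t ∈ Metric.ball x r,
        (Summable fun n => ‖a n s‖ + ‖b n s‖) → Summable fun n => ‖a n t‖ + ‖b n t‖ := by
      intro s hs t ht h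
      obtain ⟨B, hBs, hBn⟩ := hB s hs h
      exact hBs.of_nonneg_of_le (fun n => by positivity) fun n => hBn n t ht
    exact ⟨aux x hxb y hy, aux y hy x hxb⟩
  have hsa : ∀ x ∈ V, Summable fun n => a n x := fun x hx =>
    .of_norm ((hsum x hx).of_nonneg_of_le (fun _ => norm_nonneg _) fun n => by simp)
  have hsb : ∀ x ∈ V, Summable fun n => b n x := fun x hx =>
    .of_norm ((hsum x hx).of_nonneg_of_le (fun _ => norm_nonneg _) fun n => by simp)
  refine ⟨fun z => ∑' n, a n z, fun z => ∑' n, b n z, fun x hx => ?_, ?_, ?_⟩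
  · obtain ⟨r, hr, hrV, K, hK, hqK, hB⟩ := hloc x hx
    have hxb := Metric.mem_ball_self (x := x) hr
    obtain ⟨B, hBs, hBn⟩ := hB x hxb (hsum x hx)
    have series : ∀ (f g : ℕ → ℂ → ℂ) (C : ℕ → ℝ), Summable C →
        (∀ n, ∀ z ∈ V, HasDerivAt (f (n + 1)) (g n z) z) → (∃ γ, ∀ z, f 0 z = γ) →
        (∀ n, ∀ z ∈ Metric.ball x r, ‖g n z‖ ≤ C n) → (Summable fun n => f n x) →
        HasDerivAt (fun z => ∑' n, f n z) (∑' n, g n x) x := by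
      rintro f g C hC hfg ⟨γ, hγ⟩ hgC hf
      let g' : ℕ → ℂ → ℂ := fun n z => Nat.casesOn n 0 fun k => g k z
      let C' : ℕ → ℝ := fun n => Nat.casesOn n 0 C
      have hs : Summable fun n => g' n x :=
        (summable_nat_add_iff 1).1 (.of_norm_bounded hC fun n => hgC n x hxb)
      have := hasDerivAt_tsum_of_isPreconnected (g := f) (g' := g') (u := C')
        ((summable_nat_add_iff 1).1 hC) Metric.isOpen_ball (convex_ball x r).isPreconnected
        (fun n z hz => by
          cases n with
          | zero => rw [show f 0 = fun _ => γ from funext hγ]; exact hasDerivAt_const _ _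
          | succ n => exact hfg n z (hrV hz))
        (fun n z hz => by
          cases n with
          | zero => simp [g', C']
          | succ n => exact hgC n z hz) hxb hf hxb
      rwa [hs.tsum_eq_zero_add, show g' 0 x = 0 from rfl, zero_add] at this
    refine ⟨series a b B hBs (fun n z hz => (hab n z hz).1) ⟨α, fun z => (h0 z).1⟩
      (fun n z hz => by linarith [hBn n z hz, norm_nonneg (a n z)]) (hsa x hx), ?_⟩
    rw [← tsum_mul_left]
    exact series b (fun n z => q z * a n z) (fun n => K * B n) (hBs.mul_left K)
      (fun n z hz => (hab n z hz).2) ⟨β, fun z => (h0 z).2⟩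
      (fun n z hz => by
        rw [norm_mul]
        exact mul_le_mul (hqK z hz) (by linarith [hBn n z hz, norm_nonneg (b n z)])
          (norm_nonneg _) hK) (hsb x hx)
  · simp only
    rw [(hsa z₀ hz₀).tsum_eq_zero_add]
    simp [h0, hz]
  · simp only
    rw [(hsb z₀ hz₀).tsum_eq_zero_add]
    simp [h0, hz]

/-- `f` is real differentiable at `z` with `∂_z f = a` and `∂_z̄ f = b`. -/
def HasWirtingerAt (f : ℂ → ℂ) (a b z : ℂ) : Prop :=
  HasFDerivAt f (a • ContinuousLinearMap.id ℝ ℂ + b • (Complex.conjCLE : ℂ →L[ℝ] ℂ)) z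

namespace HasWirtingerAt

open ComplexConjugate

variable {f g : ℂ → ℂ} {a b c d z : ℂ}

theorem wirtingerZ_eq (h : HasWirtingerAt f a b z) : wirtingerZ f z = a := by
  rw [wirtingerZ, h.fderiv]
  simp only [add_apply, smul_apply, ContinuousLinearMap.id_apply, ContinuousLinearEquiv.coe_coe,
    Complex.conjCLE_apply, map_one, Complex.conj_I, smul_eq_mul]
  linear_combination (b - a) / 2 * Complex.I_sq

theorem wirtingerZbar_eq (h : HasWirtingerAt f a b z) : wirtingerZbar f z = b := by
  rw [wirtingerZbar, h.fderiv]
  simp only [add_apply, smul_apply, ContinuousLinearMap.id_apply, ContinuousLinearEquiv.coe_coe,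
    Complex.conjCLE_apply, map_one, Complex.conj_I, smul_eq_mul]
  linear_combination (a - b) / 2 * Complex.I_sq

theorem of_differentiableAt (h : DifferentiableAt ℝ f z) :
    HasWirtingerAt f (wirtingerZ f z) (wirtingerZbar f z) z := by
  refine h.hasFDerivAt.congr_fderiv (ContinuousLinearMap.ext fun w => ?_)
  have hw : fderiv ℝ f z w = w.re * fderiv ℝ f z 1 + w.im * fderiv ℝ f z Complex.I := by
    conv_lhs => rw [show w = w.re • (1 : ℂ) + w.im • Complex.I by simp [Complex.re_add_im]]
    rw [map_add, map_smul, map_smul, Complex.real_smul, Complex.real_smul]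
  have h1 := Complex.re_add_im w
  have h2 : (conj w : ℂ) = w.re - w.im * Complex.I := by
    apply Complex.ext <;> simp
  rw [hw]
  simp only [add_apply, smul_apply, ContinuousLinearMap.id_apply, ContinuousLinearEquiv.coe_coe,
    Complex.conjCLE_apply, smul_eq_mul, h2, wirtingerZ, wirtingerZbar]
  nth_rewrite 3 [← h1]
  linear_combination w.im * fderiv ℝ f z Complex.I * Complex.I_sq

theorem mul (hf : HasWirtingerAt f a b z) (hg : HasWirtingerAt g c d z) :
    HasWirtingerAt (fun w => f w * g w) (a * g z + f z * c) (b * g z + f z * d) z := by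
  refine (HasFDerivAt.mul hf hg).congr_fderiv (ContinuousLinearMap.ext fun w => ?_)
  simp
  ring

theorem add (hf : HasWirtingerAt f a b z) (hg : HasWirtingerAt g c d z) :
    HasWirtingerAt (fun w => f w + g w) (a + c) (b + d) z := by
  refine (HasFDerivAt.add hf hg).congr_fderiv (ContinuousLinearMap.ext fun w => ?_)
  simp
  ring

theorem sub (hf : HasWirtingerAt f a b z) (hg : HasWirtingerAt g c d z) :
    HasWirtingerAt (fun w => f w - g w) (a - c) (b - d) z := by
  refine (HasFDerivAt.sub hf hg).congr_fderiv (ContinuousLinearMap.ext fun w => ?_)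
  simp
  ring

theorem conj_comp (hf : HasWirtingerAt f a b z) :
    HasWirtingerAt (fun w => conj (f w)) (conj b) (conj a) z := by
  refine ((Complex.conjCLE : ℂ →L[ℝ] ℂ).hasFDerivAt.comp z hf).congr_fderiv
    (ContinuousLinearMap.ext fun w => ?_)
  simp
  ring

theorem _root_.HasDerivAt.hasWirtingerAt (h : HasDerivAt f a z) : HasWirtingerAt f a 0 z := by
  refine (h.hasFDerivAt.restrictScalars ℝ).congr_fderiv (ContinuousLinearMap.ext fun w => ?_)
  simp [mul_comm]

theorem hasDerivAt (h : HasWirtingerAt f a 0 z) : HasDerivAt f a z := by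
  rw [hasDerivAt_iff_hasFDerivAt]
  refine hasFDerivAt_of_restrictScalars ℝ h (ContinuousLinearMap.ext fun w => ?_)
  simp [mul_comm]

theorem comp_hasDerivAt {φ : ℂ → ℂ} (hφ : HasDerivAt φ c (f z)) (hf : HasWirtingerAt f a b z) :
    HasWirtingerAt (fun w => φ (f w)) (c * a) (c * b) z := by
  refine ((hφ.hasFDerivAt.restrictScalars ℝ).comp z hf).congr_fderiv
    (ContinuousLinearMap.ext fun w => ?_)
  simp
  ring

theorem congr (h : HasWirtingerAt f a b z) (hac : a = c) (hbd : b = d) :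
    HasWirtingerAt f c d z := hac ▸ hbd ▸ h

end HasWirtingerAt

open ComplexConjugate

/-- Structure equations for the system: with `U` real-valued, `p = ∂_z U` satisfies a closed
first order system. -/
theorem hasWirtingerAt_of_system {V : Set ℂ} (hV : IsOpen V) {ρ : ℂ → ℂ} {u : ℂ → ℝ}
    (hu : ContDiffOn ℝ (⊤ : ℕ∞) u V)
    (hLiouville : ∀ z ∈ V,
      4 * wirtingerZ (wirtingerZbar (fun w => (u w : ℂ))) z
        = Complex.exp (-2 * (u z : ℂ)))
    (hEntropy : ∀ z ∈ V,
      wirtingerZ (wirtingerZ (fun w => (u w : ℂ))) z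
        + (wirtingerZ (fun w => (u w : ℂ)) z) ^ 2 = -ρ z / 4) :
    ∃ p : ℂ → ℂ, ∀ z ∈ V, HasWirtingerAt (fun w => (u w : ℂ)) (p z) (conj (p z)) z ∧
      HasWirtingerAt p (-ρ z / 4 - p z ^ 2) (Complex.exp (-(u z : ℂ)) ^ 2 / 4) z := by
  have hU : ContDiffOn ℝ (⊤ : ℕ∞) (fun w => (u w : ℂ)) V :=
    Complex.ofRealCLM.contDiff.comp_contDiffOn hu
  have hUd : ∀ z ∈ V, DifferentiableAt ℝ (fun w => (u w : ℂ)) z := fun z hz =>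
    (hU.differentiableOn (by simp)).differentiableAt (hV.mem_nhds hz)
  have hfd : ∀ z ∈ V, DifferentiableAt ℝ (fderiv ℝ (fun w => (u w : ℂ))) z := fun z hz =>
    ((hU.fderiv_of_isOpen (m := 1) hV (by norm_cast)).differentiableOn
      (by simp)).differentiableAt (hV.mem_nhds hz)
  set p := wirtingerZ (fun w => (u w : ℂ)) with hp
  have hW := fun z hz => HasWirtingerAt.of_differentiableAt (hUd z hz)
  have hbar : ∀ z ∈ V, wirtingerZbar (fun w => (u w : ℂ)) z = conj (p z) := fun z hz => by
    have h := (hW z hz).conj_comp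
    simp only [Complex.conj_ofReal] at h
    exact h.wirtingerZbar_eq
  have hpd : ∀ z ∈ V, DifferentiableAt ℝ p z := fun z hz => by
    have h := hfd z hz
    unfold wirtingerZ at hp
    rw [hp]
    exact ((h.clm_apply (differentiableAt_const _)).sub
      ((h.clm_apply (differentiableAt_const _)).const_mul _)).const_mul _
  refine ⟨p, fun z hz => ⟨hbar z hz ▸ hW z hz, ?_⟩⟩
  have hpW := HasWirtingerAt.of_differentiableAt (hpd z hz)
  have hcongr : wirtingerZ (wirtingerZbar (fun w => (u w : ℂ))) z = conj (wirtingerZbar p z) := by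
    have : wirtingerZbar (fun w => (u w : ℂ)) =ᶠ[nhds z] fun w => conj (p w) := by
      filter_upwards [hV.mem_nhds hz] with w hw using hbar w hw
    rw [wirtingerZ, this.fderiv_eq]
    exact hpW.conj_comp.wirtingerZ_eq
  refine hpW.congr (by linear_combination hEntropy z hz) ?_
  have h := hLiouville z hz
  rw [hcongr] at h
  have h' := congrArg conj h
  rw [map_mul, Complex.conj_conj, ← Complex.exp_conj] at h'
  simp only [map_mul, map_neg, Complex.conj_ofReal, map_ofNat] at h'
  rw [← Complex.exp_nat_mul]
  push_cast
  rw [mul_neg, ← neg_mul, ← h']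
  ring

/-- The conjugate of `w ∂_z f - w' f`, for `f = e^u` and `w` a solution of Hill's equation,
is again a solution of Hill's equation. -/
theorem isHillPair_conj {V : Set ℂ} {ρ u p w v : ℂ → ℂ} (hreal : ∀ z, conj (u z) = u z)
    (hu : ∀ z ∈ V, HasWirtingerAt u (p z) (conj (p z)) z)
    (hp : ∀ z ∈ V, HasWirtingerAt p (-ρ z / 4 - p z ^ 2) (Complex.exp (-u z) ^ 2 / 4) z)
    (hw : IsHillPair (fun z => -ρ z / 4) V w v) :
    IsHillPair (fun z => -ρ z / 4) V (fun z => conj (Complex.exp (u z) * (w z * p z - v z)))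
      (fun z => conj (conj (p z) * (Complex.exp (u z) * (w z * p z - v z)) +
        w z * Complex.exp (-u z) / 4)) := by
  intro z hz
  have hE : HasWirtingerAt (fun z => Complex.exp (u z)) _ _ z :=
    (hu z hz).comp_hasDerivAt (Complex.hasDerivAt_exp _)
  have hN : HasWirtingerAt (fun z => Complex.exp (-u z)) _ _ z :=
    (hu z hz).comp_hasDerivAt (φ := fun t => Complex.exp (-t)) (hasDerivAt_neg (u z)).cexp
  have hww := (hw z hz).1.hasWirtingerAt
  have hvw := (hw z hz).2.hasWirtingerAt
  have hEN : Complex.exp (u z) * Complex.exp (-u z) = 1 := by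
    rw [← Complex.exp_add, add_neg_cancel, Complex.exp_zero]
  have hNr : conj (Complex.exp (-u z)) = Complex.exp (-u z) := by
    rw [← Complex.exp_conj, map_neg, hreal]
  have hg := hE.mul ((hww.mul (hp z hz)).sub hvw)
  have hg' := hg.congr (c := 0) (d := conj (p z) * (Complex.exp (u z) * (w z * p z - v z)) +
        w z * Complex.exp (-u z) / 4) (by ring)
        (by linear_combination w z * Complex.exp (-u z) / 4 * hEN)
  have hpc := (hp z hz).conj_comp
  have hh := (hpc.mul hg').add ((hww.mul hN).mul
    ((hasDerivAt_const z (1 / 4 : ℂ)).hasWirtingerAt))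
  have hh' := hh.congr (c := 0)
    (d := conj (-ρ z / 4) * (Complex.exp (u z) * (w z * p z - v z)))
    (by
      simp only [map_div₀, map_pow, hNr, map_ofNat]
      linear_combination Complex.exp (-u z) / 4 * (w z * p z - v z) * hEN)
    (by
      simp only [map_sub, map_pow]
      ring)
  constructor
  · exact (hg'.conj_comp.congr rfl (map_zero _)).hasDerivAt
  · have := (hh'.conj_comp.congr rfl (map_zero _)).hasDerivAt
    rw [map_mul, Complex.conj_conj] at this
    simpa only [mul_one_div] using this

/-- On a nonempty simply connected domain `V ⊆ ℂ` with `ρ` holomorphic, every smooth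
real-valued solution `u` of the system `4 ∂_z ∂_z̄ u = e^(-2u)`,
`∂²_zz u + (∂_z u)² = -ρ/4` is of the form `u = log(|w₁|² + |w₂|²)` for holomorphic
solutions `w₁, w₂` of Hill's equation `w'' + (ρ/4) w = 0` with Wronskian `1/2`. -/
theorem solution_of_system_from_hill
    (V : Set ℂ) (hV : IsOpen V) (hVconn : IsConnected V)
    (hVsc : SimplyConnectedSpace V)
    (ρ : ℂ → ℂ) (hρ : DifferentiableOn ℂ ρ V)
    (u : ℂ → ℝ) (hu : ContDiffOn ℝ (⊤ : ℕ∞) u V)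
    (hLiouville : ∀ z ∈ V,
      4 * wirtingerZ (wirtingerZbar (fun w => (u w : ℂ))) z
        = Complex.exp (-2 * (u z : ℂ)))
    (hEntropy : ∀ z ∈ V,
      wirtingerZ (wirtingerZ (fun w => (u w : ℂ))) z
        + (wirtingerZ (fun w => (u w : ℂ)) z) ^ 2 = -ρ z / 4) :
    ∃ w₁ w₂ : ℂ → ℂ,
      DifferentiableOn ℂ w₁ V ∧ DifferentiableOn ℂ w₂ V ∧
      (∀ z ∈ V, deriv (deriv w₁) z + ρ z / 4 * w₁ z = 0) ∧
      (∀ z ∈ V, deriv (deriv w₂) z + ρ z / 4 * w₂ z = 0) ∧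
      (∀ z ∈ V, w₁ z * deriv w₂ z - w₂ z * deriv w₁ z = 1 / 2) ∧
      (∀ z ∈ V, u z = Real.log (‖w₁ z‖ ^ 2 + ‖w₂ z‖ ^ 2)) := by
  obtain ⟨p, hp⟩ := hasWirtingerAt_of_system hV hu hLiouville hEntropy
  obtain ⟨z₀, hz₀⟩ := hVconn.nonempty
  have hVc := hVconn.isPreconnected
  have hq : DifferentiableOn ℂ (fun z => -ρ z / 4) V := hρ.neg.div_const 4
  set a : ℂ := Complex.exp (u z₀ / 2) with ha
  have ha0 : a ≠ 0 := Complex.exp_ne_zero _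
  have haE : Complex.exp (u z₀) = a * a := by rw [ha, ← Complex.exp_add, add_halves]
  have haN : Complex.exp (-(u z₀ : ℂ)) = 1 / (a * a) := by
    rw [Complex.exp_neg, haE, one_div]
  have har : conj a = a := by
    rw [ha, ← Complex.exp_conj, map_div₀, Complex.conj_ofReal, map_ofNat]
  obtain ⟨w₁, v₁, h₁, hw₁, hv₁⟩ := exists_isHillPair hV hq hz₀ a (p z₀ * a)
  obtain ⟨w₂, v₂, h₂, hw₂, hv₂⟩ := exists_isHillPair hV hq hz₀ 0 (1 / (2 * a))
  have hW₀ : w₁ z₀ * v₂ z₀ - w₂ z₀ * v₁ z₀ = 1 / 2 := by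
    rw [hw₁, hw₂, hv₂]
    field_simp
    ring
  have hW : ∀ z ∈ V, w₁ z * v₂ z - w₂ z * v₁ z = 1 / 2 := fun z hz =>
    (h₁.wronskian_eq h₂ hV hVc hz hz₀).trans hW₀
  have hWne : w₁ z₀ * v₂ z₀ - w₂ z₀ * v₁ z₀ ≠ 0 := by rw [hW₀]; norm_num
  have hconj := fun {w v : ℂ → ℂ} (h : IsHillPair (fun z => -ρ z / 4) V w v) =>
    isHillPair_conj (u := fun z => (u z : ℂ)) (fun z => Complex.conj_ofReal _)
      (fun z hz => (hp z hz).1) (fun z hz => (hp z hz).2) h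
  have e₁ : ∀ z ∈ V, conj (Complex.exp (u z) * (w₁ z * p z - v₁ z)) = 1 / 2 * w₂ z :=
    fun z hz => (hconj h₁).eq_of_initial (h₂.const_mul (1 / 2)) h₁ h₂ hV hVc hz₀ hWne
      (by simp only [hw₁, hw₂, hv₁, mul_comm a, sub_self, mul_zero, map_zero])
      (by
        simp only [hw₁, hv₁, hv₂, haN, mul_comm a, sub_self, mul_zero, zero_add, map_div₀,
          map_mul, map_one, map_ofNat, har]
        field_simp
        norm_num) hz
  have e₂ : ∀ z ∈ V, conj (Complex.exp (u z) * (w₂ z * p z - v₂ z)) = -1 / 2 * w₁ z :=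
    fun z hz => (hconj h₂).eq_of_initial (h₁.const_mul (-1 / 2)) h₁ h₂ hV hVc hz₀ hWne
      (by
        simp only [hw₁, hw₂, hv₂, haE, zero_mul, zero_sub, map_mul, map_neg, map_div₀, map_one,
          map_ofNat, har]
        field_simp)
      (by
        simp only [hw₂, hv₁, hv₂, haE, zero_mul, zero_sub, zero_div, add_zero, map_mul, map_neg,
          map_div₀, map_one, map_ofNat, har, Complex.conj_conj]
        field_simp) hz
  refine ⟨w₁, w₂, h₁.differentiableOn, h₂.differentiableOn, fun z hz => ?_, fun z hz => ?_,
    fun z hz => ?_, fun z hz => ?_⟩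
  · rw [h₁.deriv_deriv_eq hV hz]
    ring
  · rw [h₂.deriv_deriv_eq hV hz]
    ring
  · rw [h₁.deriv_eq hz, h₂.deriv_eq hz, hW z hz]
  · have f₁ := congrArg conj (e₁ z hz)
    have f₂ := congrArg conj (e₂ z hz)
    simp only [Complex.conj_conj, map_mul, map_div₀, map_neg, map_one, map_ofNat] at f₁ f₂
    have key : Complex.exp (u z) = w₁ z * conj (w₁ z) + w₂ z * conj (w₂ z) := by
      linear_combination -2 * Complex.exp (u z) * hW z hz - 2 * w₁ z * f₂ + 2 * w₂ z * f₁
    rw [Complex.mul_conj', Complex.mul_conj'] at key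
    have key' : Real.exp (u z) = ‖w₁ z‖ ^ 2 + ‖w₂ z‖ ^ 2 := by exact_mod_cast key
    rw [← key', Real.log_exp]
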